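/- arXiv:2202.01687 — 5 statements merged into one kernel-verified Lean document; each statement's English description precedes it below -/
import Mathlib

section
/- Let (β, σ, ρ) lie in the parameter domain A, i.e. β > 0, σ > 0, ρ > 1 and ρ > (σ+1)²/(4σ). Then β(2√(σρ) − σ − 1) > 0, and every point p = (x,y,z) on the paraboloid P satisfying ⟨N(p), X(p)⟩ = 0 and x² < β(2√(σρ) − σ − 1) is the origin. In particular, the origin is an isolated point of the tangency locus {p ∈ P : ⟨N(p), X(p)⟩ = 0}. -/
/-- The Lorenz vector field with parameters `σ ρ β`. -/
noncomputable def lorenz (σ ρ β : ℝ) (p : Fin 3 → ℝ) : Fin 3 → ℝ :=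
  ![σ * (p 1 - p 0), ρ * p 0 - p 1 - p 0 * p 2, p 0 * p 1 - β * p 2]

/-- The normal vector field `N(x,y,z) = (y, x, −β)` to the paraboloid `{xy = βz}`. -/
noncomputable def normalP (β : ℝ) (p : Fin 3 → ℝ) : Fin 3 → ℝ := ![p 1, p 0, -β]

/-- The standard inner (dot) product on `ℝ³`. -/
def dot3 (u v : Fin 3 → ℝ) : ℝ := u 0 * v 0 + u 1 * v 1 + u 2 * v 2

/-- A binary quadratic form `a y² - c x y + b x²` of negative discriminant vanishes only at `0`. -/
lemma eq_zero_of_quadratic_form_eq_zero {a b c x y : ℝ} (ha : 0 < a) (hc : c ^ 2 < 4 * (a * b))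
    (h : a * y ^ 2 - c * x * y + b * x ^ 2 = 0) : x = 0 ∧ y = 0 := by
  have hsum : (2 * a * y - c * x) ^ 2 + (4 * (a * b) - c ^ 2) * x ^ 2 = 0 := by
    linear_combination 4 * a * h
  have hx : x = 0 := by
    by_contra hx
    have hpos : 0 < (4 * (a * b) - c ^ 2) * x ^ 2 := mul_pos (sub_pos.2 hc) (by positivity)
    linarith [sq_nonneg (2 * a * y - c * x)]
  subst hx
  simpa [ha.ne'] using h

/-- A tangency point with `x² < β(2√(σρ) - σ - 1)` is the origin. -/
lemma eq_zero_of_tangent_of_sq_lt {β σ ρ : ℝ} (hβ : 0 < β) (hσ : 0 < σ) (hρ : 0 < ρ)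
    {p : Fin 3 → ℝ} (hP : p 0 * p 1 = β * p 2)
    (hT : dot3 (normalP β p) (lorenz σ ρ β p) = 0)
    (hx : p 0 ^ 2 < β * (2 * √(σ * ρ) - σ - 1)) : p = 0 := by
  have hlt : p 0 ^ 2 / β < 2 * √(σ * ρ) - σ - 1 := (div_lt_iff₀' hβ).2 hx
  have hc : (σ + 1 + p 0 ^ 2 / β) ^ 2 < 4 * (σ * ρ) := by
    calc (σ + 1 + p 0 ^ 2 / β) ^ 2 < (2 * √(σ * ρ)) ^ 2 :=
          pow_lt_pow_left₀ (by linarith) (by positivity) two_ne_zero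
      _ = 4 * (σ * ρ) := by rw [mul_pow, Real.sq_sqrt (by positivity)]; norm_num
  have hz : p 2 = p 0 * p 1 / β := by rw [hP]; field_simp
  have hform : σ * p 1 ^ 2 - (σ + 1 + p 0 ^ 2 / β) * p 0 * p 1 + ρ * p 0 ^ 2 = 0 := by
    simp only [dot3, normalP, lorenz, Matrix.cons_val] at hT
    linear_combination hT + β * hP + p 0 ^ 2 * hz
  obtain ⟨h0, h1⟩ := eq_zero_of_quadratic_form_eq_zero hσ hc hform
  ext i
  fin_cases i <;> simp [h0, h1, hz]

/-- In the parameter domain `A` (`β, σ > 0`, `ρ > 1`, `ρ > (σ+1)²/(4σ)`):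
`β(2√(σρ) − σ − 1) > 0`; every tangency point of the Lorenz field with the
paraboloid whose `x`-coordinate satisfies `x² < β(2√(σρ) − σ − 1)` is the origin;
and in particular the origin is an isolated point of the tangency locus. -/
theorem tangency_isolated_at_origin (β σ ρ : ℝ) (hβ : 0 < β) (hσ : 0 < σ)
    (hρ : 1 < ρ) (hρ' : (σ + 1) ^ 2 / (4 * σ) < ρ) :
    0 < β * (2 * Real.sqrt (σ * ρ) - σ - 1) ∧
    (∀ p : Fin 3 → ℝ, p 0 * p 1 = β * p 2 →
      dot3 (normalP β p) (lorenz σ ρ β p) = 0 →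
      (p 0) ^ 2 < β * (2 * Real.sqrt (σ * ρ) - σ - 1) → p = 0) ∧
    (∃ ε > (0 : ℝ), ∀ p : Fin 3 → ℝ, p 0 * p 1 = β * p 2 →
      dot3 (normalP β p) (lorenz σ ρ β p) = 0 → ‖p‖ < ε → p = 0) := by
  have hρ₀ : 0 < ρ := one_pos.trans hρ
  have hσρ : (σ + 1) ^ 2 < 4 * (σ * ρ) := by
    rw [div_lt_iff₀ (by positivity)] at hρ'
    linarith
  have hsqrt : (σ + 1) / 2 < √(σ * ρ) := Real.lt_sqrt_of_sq_lt (by linarith)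
  have hpos : 0 < β * (2 * √(σ * ρ) - σ - 1) := mul_pos hβ (by linarith)
  refine ⟨hpos, fun p hP hT hx => eq_zero_of_tangent_of_sq_lt hβ hσ hρ₀ hP hT hx,
    √(β * (2 * √(σ * ρ) - σ - 1)), Real.sqrt_pos.2 hpos, fun p hP hT hp => ?_⟩
  refine eq_zero_of_tangent_of_sq_lt hβ hσ hρ₀ hP hT (Real.sq_lt.2 (abs_lt.1 ?_))
  exact (norm_le_pi_norm p 0).trans_lt hp
end

section
/- Let σ, ρ, β > 0 and V(x,y,z) = ρx² + σy² + σ(z−2ρ)². There exists c₀ > 0 such that for every c ≥ c₀ the sublevel set {p ∈ ℝ³ : V(p) ≤ c} is forward invariant for the Lorenz equations: if f : [0,T] → ℝ³ satisfies f′(t) = X(f(t)) for all t ∈ [0,T] and V(f(0)) ≤ c, then V(f(t)) ≤ c for all t ∈ [0,T]. -/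
/-- The Lyapunov function `V(x,y,z) = ρx² + σy² + σ(z−2ρ)²`. -/
noncomputable def lyapV (σ ρ : ℝ) (p : Fin 3 → ℝ) : ℝ :=
  ρ * (p 0) ^ 2 + σ * (p 1) ^ 2 + σ * (p 2 - 2 * ρ) ^ 2

/-- The derivative of the Lyapunov function along a solution of the Lorenz equations. -/
theorem hasDerivWithinAt_lyapV_comp {σ ρ β t : ℝ} {f : ℝ → Fin 3 → ℝ} {s : Set ℝ}
    (hf : HasDerivWithinAt f (lorenz σ ρ β (f t)) s t) :
    HasDerivWithinAt (fun u => lyapV σ ρ (f u))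
      (-2 * σ * (ρ * (f t 0) ^ 2 + (f t 1) ^ 2 + β * (f t 2 - ρ) ^ 2 - β * ρ ^ 2)) s t := by
  have hcoord := hasDerivWithinAt_pi.1 hf
  have h := ((((hcoord 0).pow 2).const_mul ρ).add (((hcoord 1).pow 2).const_mul σ)).add
    ((((hcoord 2).sub_const (2 * ρ)).pow 2).const_mul σ)
  refine h.congr_deriv ?_
  simp [lorenz]
  ring

/-- The Lyapunov function is bounded on the ellipsoid where it fails to decrease strictly. -/
theorem lyapV_le_of_ellipsoid {σ ρ β : ℝ} (hσ : 0 < σ) (hρ : 0 < ρ) (hβ : 0 < β) {p : Fin 3 → ℝ}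
    (hp : ρ * (p 0) ^ 2 + (p 1) ^ 2 + β * (p 2 - ρ) ^ 2 ≤ β * ρ ^ 2) :
    lyapV σ ρ p ≤ β * ρ ^ 2 + σ * (β * ρ ^ 2) + σ * (4 * ρ ^ 2) := by
  have hx₀ : 0 ≤ ρ * (p 0) ^ 2 := by positivity
  have hy₀ : 0 ≤ (p 1) ^ 2 := sq_nonneg _
  have hz₀ : 0 ≤ β * (p 2 - ρ) ^ 2 := by positivity
  have hx : ρ * (p 0) ^ 2 ≤ β * ρ ^ 2 := by linarith
  have hy : (p 1) ^ 2 ≤ β * ρ ^ 2 := by linarith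
  have hz : (p 2 - ρ) ^ 2 ≤ ρ ^ 2 := le_of_mul_le_mul_left (by linarith) hβ
  have hz' : (p 2 - 2 * ρ) ^ 2 ≤ 4 * ρ ^ 2 := by nlinarith [sq_nonneg (p 2)]
  unfold lyapV
  gcongr

/-- For `σ, ρ, β > 0`, all large enough sublevel sets `{V ≤ c}` of the Lyapunov
function `V(x,y,z) = ρx² + σy² + σ(z−2ρ)²` are forward invariant for the Lorenz
equations. -/
theorem sublevel_sets_forward_invariant (σ ρ β : ℝ)
    (hσ : 0 < σ) (hρ : 0 < ρ) (hβ : 0 < β) :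
    ∃ c₀ > (0 : ℝ), ∀ c ≥ c₀, ∀ (T : ℝ) (f : ℝ → Fin 3 → ℝ),
      (∀ t ∈ Set.Icc (0 : ℝ) T,
        HasDerivWithinAt f (lorenz σ ρ β (f t)) (Set.Icc (0 : ℝ) T) t) →
      lyapV σ ρ (f 0) ≤ c →
      ∀ t ∈ Set.Icc (0 : ℝ) T, lyapV σ ρ (f t) ≤ c := by
  refine ⟨β * ρ ^ 2 + σ * (β * ρ ^ 2) + σ * (4 * ρ ^ 2) + 1, by positivity, ?_⟩
  intro c hc T f hf h0 t ht
  have hderiv := fun u hu => hasDerivWithinAt_lyapV_comp (hf u hu)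
  refine image_le_of_deriv_right_lt_deriv_boundary (B := fun _ => c) (B' := fun _ => 0)
    (fun u hu => (hderiv u hu).continuousWithinAt)
    (fun u hu => (hderiv u (Set.Ico_subset_Icc_self hu)).mono_of_mem_nhdsWithin
      (Icc_mem_nhdsGE_of_mem hu)) h0 (fun u => hasDerivAt_const u c) ?_ ht
  intro u _ hVc
  by_contra! hnonneg
  have hp : ρ * (f u 0) ^ 2 + (f u 1) ^ 2 + β * (f u 2 - ρ) ^ 2 ≤ β * ρ ^ 2 := by
    by_contra! hlt
    have := mul_pos hσ (sub_pos.2 hlt)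
    linarith
  have := lyapV_le_of_ellipsoid hσ hρ hβ hp
  linarith
end

section
/- Let σ, ρ, β > 0. For every initial point p₀ ∈ ℝ³ there exists a solution f : [0,∞) → ℝ³ of the Lorenz equations with f(0) = p₀, i.e. f′(t) = X(f(t)) for all t ≥ 0; moreover every such solution is bounded: there exists C > 0 (depending on p₀) with ‖f(t)‖ ≤ C for all t ≥ 0. In particular, no forward orbit of the Lorenz equations escapes to infinity. -/
open Set Filter Topology
open scoped NNReal

section GlobalExistence

variable {E : Type*} [NormedAddCommGroup E] [NormedSpace ℝ E]

/-- A bounded, globally Lipschitz autonomous vector field has forward solutions on every compact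
time interval `[0, T]`. -/
lemma LipschitzWith.exists_solution_Icc [CompleteSpace E] {v : E → E} {K L : ℝ≥0}
    (hv : LipschitzWith K v) (hL : ∀ x, ‖v x‖ ≤ L) (x : E) (T : ℝ≥0) :
    ∃ α : ℝ → E, α 0 = x ∧
      ∀ t ∈ Icc (0 : ℝ) T, HasDerivWithinAt α (v (α t)) (Icc (0 : ℝ) T) t := by
  have hpl : IsPicardLindelof (fun _ ↦ v) (tmin := 0) (tmax := T)
      ⟨0, left_mem_Icc.2 T.2⟩ x (L * T) 0 L K :=
    .of_time_independent (fun y _ ↦ hL y) hv.lipschitzOnWith (by simp)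
  exact hpl.exists_eq_forall_mem_Icc_hasDerivWithinAt₀

/-- A bounded, globally Lipschitz autonomous vector field has forward solutions on `[0, ∞)`. -/
lemma LipschitzWith.exists_solution_Ici [CompleteSpace E] {v : E → E} {K L : ℝ≥0}
    (hv : LipschitzWith K v) (hL : ∀ x, ‖v x‖ ≤ L) (x : E) :
    ∃ f : ℝ → E, f 0 = x ∧
      ∀ t ∈ Ici (0 : ℝ), HasDerivWithinAt f (v (f t)) (Ici (0 : ℝ)) t := by
  choose α hα0 hα using fun n : ℕ ↦ hv.exists_solution_Icc hL x n
  simp only [NNReal.coe_natCast] at hα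
  have hIcc {n : ℕ} {t : ℝ} (ht : t ∈ Ico (0 : ℝ) n) : Icc (0 : ℝ) n ∈ 𝓝[Ici 0] t := by
    rw [← Ici_inter_Iic]
    exact inter_mem self_mem_nhdsWithin (mem_nhdsWithin_of_mem_nhds (Iic_mem_nhds ht.2))
  have hder {n : ℕ} {t : ℝ} (ht : t ∈ Ico (0 : ℝ) n) :
      HasDerivWithinAt (α n) (v (α n t)) (Ici 0) t :=
    (hα n t (Ico_subset_Icc_self ht)).mono_of_mem_nhdsWithin (hIcc ht)
  have heq {m n : ℕ} {t : ℝ} (h0 : 0 ≤ t) (hm : t ≤ m) (hn : t ≤ n) : α m t = α n t :=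
    ODE_solution_unique_of_mem_Icc_right (v := fun _ ↦ v) (s := fun _ ↦ univ) (K := K)
      (fun _ _ ↦ hv.lipschitzOnWith)
      (HasDerivWithinAt.continuousOn fun s hs ↦
        (hα m s ⟨hs.1, hs.2.trans hm⟩).mono (Icc_subset_Icc_right hm))
      (fun s hs ↦ (hder ⟨hs.1, hs.2.trans_le hm⟩).mono (Ici_subset_Ici.2 hs.1))
      (fun _ _ ↦ mem_univ _)
      (HasDerivWithinAt.continuousOn fun s hs ↦
        (hα n s ⟨hs.1, hs.2.trans hn⟩).mono (Icc_subset_Icc_right hn))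
      (fun s hs ↦ (hder ⟨hs.1, hs.2.trans_le hn⟩).mono (Ici_subset_Ici.2 hs.1))
      (fun _ _ ↦ mem_univ _) ((hα0 m).trans (hα0 n).symm) (right_mem_Icc.2 h0)
  refine ⟨fun t ↦ α ⌈t⌉₊ t, hα0 _, fun t (ht : 0 ≤ t) ↦ ?_⟩
  have htn : t ∈ Ico (0 : ℝ) (⌈t⌉₊ + 1 : ℕ) :=
    ⟨ht, (Nat.le_ceil t).trans_lt (by exact_mod_cast Nat.lt_succ_self _)⟩
  have hf {s : ℝ} (hs : s ∈ Icc (0 : ℝ) (⌈t⌉₊ + 1 : ℕ)) : α ⌈s⌉₊ s = α (⌈t⌉₊ + 1) s :=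
    heq hs.1 (Nat.le_ceil s) hs.2
  beta_reduce
  rw [hf (Ico_subset_Icc_self htn)]
  exact (hder htn).congr_of_eventuallyEq (mem_of_superset (hIcc htn) fun s hs ↦ hf hs)
    (hf (Ico_subset_Icc_self htn))

end GlobalExistence

/-- The Lyapunov function `x² + y² + (z - σ - ρ)²` of the Lorenz system. -/
noncomputable def lorenzEnergy (σ ρ : ℝ) (p : Fin 3 → ℝ) : ℝ :=
  p 0 ^ 2 + p 1 ^ 2 + (p 2 - (σ + ρ)) ^ 2

lemma norm_le_of_lorenzEnergy_le {σ ρ B : ℝ} (hσ : 0 < σ) (hρ : 0 < ρ) {p : Fin 3 → ℝ}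
    (hp : lorenzEnergy σ ρ p ≤ B) : ‖p‖ ≤ √B + (σ + ρ) := by
  unfold lorenzEnergy at hp
  have h0 : |p 0| ≤ √B := Real.abs_le_sqrt (by nlinarith)
  have h1 : |p 1| ≤ √B := Real.abs_le_sqrt (by nlinarith)
  have h2 : |p 2 - (σ + ρ)| ≤ √B := Real.abs_le_sqrt (by nlinarith)
  refine (pi_norm_le_iff_of_nonneg (by positivity)).2 fun i ↦ ?_
  rw [Real.norm_eq_abs]
  fin_cases i
  · exact h0.trans (by linarith)
  · exact h1.trans (by linarith)
  · have := abs_le.1 h2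
    exact abs_le.2 (show -(√B + (σ + ρ)) ≤ p 2 ∧ p 2 ≤ √B + (σ + ρ) by constructor <;> linarith)

/-- Outside a large sublevel set, the energy strictly decreases along the Lorenz field. -/
lemma lorenzEnergy_deriv_neg {σ ρ β : ℝ} (hσ : 0 < σ) (hβ : 0 < β) {p : Fin 3 → ℝ}
    (hp : β * (σ + ρ) ^ 2 / min (min (2 * σ) 2) β < lorenzEnergy σ ρ p) :
    2 * p 0 * lorenz σ ρ β p 0 + 2 * p 1 * lorenz σ ρ β p 1
      + 2 * (p 2 - (σ + ρ)) * lorenz σ ρ β p 2 < 0 := by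
  set m := min (min (2 * σ) 2) β with hm
  have hm0 : 0 < m := by positivity
  have h1 : m ≤ 2 * σ := (min_le_left _ _).trans (min_le_left _ _)
  have h2 : m ≤ 2 := (min_le_left _ _).trans (min_le_right _ _)
  have h3 : m ≤ β := min_le_right _ _
  rw [div_lt_iff₀ hm0] at hp
  unfold lorenzEnergy at hp
  have e1 := mul_le_mul_of_nonneg_right h1 (sq_nonneg (p 0))
  have e2 := mul_le_mul_of_nonneg_right h2 (sq_nonneg (p 1))
  have e3 := mul_le_mul_of_nonneg_right h3 (sq_nonneg (p 2 - (σ + ρ)))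
  have e4 := mul_nonneg hβ.le (sq_nonneg (p 2))
  simp only [lorenz, Matrix.cons_val]
  linarith

lemma lorenzEnergy_hasDerivWithinAt {σ ρ : ℝ} {f : ℝ → Fin 3 → ℝ} {w : Fin 3 → ℝ} {s : Set ℝ}
    {t : ℝ} (hf : HasDerivWithinAt f w s t) :
    HasDerivWithinAt (fun t ↦ lorenzEnergy σ ρ (f t))
      (2 * f t 0 * w 0 + 2 * f t 1 * w 1 + 2 * (f t 2 - (σ + ρ)) * w 2) s t := by
  have h := hasDerivWithinAt_pi.1 hf
  simpa [lorenzEnergy] using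
    (((h 0).fun_pow 2).fun_add ((h 1).fun_pow 2)).fun_add (((h 2).sub_const (σ + ρ)).fun_pow 2)

/-- Large sublevel sets of the energy are forward invariant for every vector field that agrees with
the Lorenz field on them. -/
lemma lorenzEnergy_le_of_solution {σ ρ β B : ℝ} (hσ : 0 < σ) (hβ : 0 < β)
    (hB : β * (σ + ρ) ^ 2 / min (min (2 * σ) 2) β < B) {v : (Fin 3 → ℝ) → Fin 3 → ℝ}
    (hv : ∀ p, lorenzEnergy σ ρ p ≤ B → v p = lorenz σ ρ β p) {f : ℝ → Fin 3 → ℝ}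
    (hf0 : lorenzEnergy σ ρ (f 0) ≤ B)
    (hf : ∀ t ∈ Ici (0 : ℝ), HasDerivWithinAt f (v (f t)) (Ici (0 : ℝ)) t) {t : ℝ} (ht : 0 ≤ t) :
    lorenzEnergy σ ρ (f t) ≤ B := by
  have hE (s : ℝ) (hs : 0 ≤ s) :=
    lorenzEnergy_hasDerivWithinAt (σ := σ) (ρ := ρ) (hf s hs)
  refine image_le_of_deriv_right_lt_deriv_boundary (B := fun _ ↦ B) (B' := 0)
    (fun s hs ↦ ((hE s hs.1).mono Icc_subset_Ici_self).continuousWithinAt)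
    (fun s hs ↦ (hE s hs.1).mono (Ici_subset_Ici.2 hs.1)) hf0
    (fun s ↦ hasDerivAt_const s B) (fun s hs hsB ↦ ?_) (right_mem_Icc.2 ht)
  rw [hv _ hsB.le]
  exact lorenzEnergy_deriv_neg hσ hβ (hsB ▸ hB)

lemma contDiff_lorenz (σ ρ β : ℝ) : ContDiff ℝ 1 (lorenz σ ρ β) := by
  refine contDiff_pi.2 fun i ↦ ?_
  fin_cases i <;> simp only [lorenz, Fin.reduceFinMk, Fin.zero_eta, Fin.mk_one, Matrix.cons_val] <;>
    fun_prop

/-- A `C¹` vector field on a finite-dimensional space can be modified outside a given ball so that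
it becomes bounded and globally Lipschitz. -/
lemma ContDiff.exists_lipschitzWith_bounded_eqOn {E : Type*} [NormedAddCommGroup E]
    [NormedSpace ℝ E] [FiniteDimensional ℝ E] {v : E → E} (hv : ContDiff ℝ 1 v) (R : ℝ) :
    ∃ (w : E → E) (K L : ℝ≥0), LipschitzWith K w ∧ (∀ x, ‖w x‖ ≤ L) ∧
      ∀ x, ‖x‖ ≤ R → w x = v x := by
  let φ : ContDiffBump (0 : E) := ⟨max R 1, max R 1 + 1, by positivity, by simp⟩
  have hsupp : HasCompactSupport fun x ↦ φ x • v x := φ.hasCompactSupport.smul_right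
  have hdiff : ContDiff ℝ 1 fun x ↦ φ x • v x := φ.contDiff.smul hv
  obtain ⟨K, hK⟩ := hdiff.lipschitzWith_of_hasCompactSupport hsupp one_ne_zero
  obtain ⟨C, hC⟩ := hsupp.exists_bound_of_continuous hdiff.continuous
  refine ⟨_, K, C.toNNReal, hK, fun x ↦ (hC x).trans (Real.le_coe_toNNReal C), fun x hx ↦ ?_⟩
  rw [φ.one_of_mem_closedBall (mem_closedBall_zero_iff.2 (hx.trans (le_max_left R 1))), one_smul]

/-- For `σ, ρ, β > 0`: through every initial point there is a forward solution
of the Lorenz equations defined on all of `[0,∞)`, and every forward solution is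
bounded — no forward orbit escapes to infinity. -/
theorem lorenz_global_forward_solutions_bounded (σ ρ β : ℝ)
    (hσ : 0 < σ) (hρ : 0 < ρ) (hβ : 0 < β) (p₀ : Fin 3 → ℝ) :
    (∃ f : ℝ → Fin 3 → ℝ, f 0 = p₀ ∧
      ∀ t ∈ Set.Ici (0 : ℝ),
        HasDerivWithinAt f (lorenz σ ρ β (f t)) (Set.Ici (0 : ℝ)) t) ∧
    (∀ f : ℝ → Fin 3 → ℝ, f 0 = p₀ →
      (∀ t ∈ Set.Ici (0 : ℝ),
        HasDerivWithinAt f (lorenz σ ρ β (f t)) (Set.Ici (0 : ℝ)) t) →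
      ∃ C > (0 : ℝ), ∀ t ∈ Set.Ici (0 : ℝ), ‖f t‖ ≤ C) := by
  obtain ⟨B, hB⟩ := exists_gt
    (max (lorenzEnergy σ ρ p₀) (β * (σ + ρ) ^ 2 / min (min (2 * σ) 2) β))
  obtain ⟨hB₀, hB⟩ := max_lt_iff.1 hB
  constructor
  · obtain ⟨w, K, L, hK, hL, hw⟩ :=
      (contDiff_lorenz σ ρ β).exists_lipschitzWith_bounded_eqOn (√B + (σ + ρ))
    have hw' (p : Fin 3 → ℝ) (hp : lorenzEnergy σ ρ p ≤ B) : w p = lorenz σ ρ β p :=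
      hw p (norm_le_of_lorenzEnergy_le hσ hρ hp)
    obtain ⟨f, hf0, hf⟩ := hK.exists_solution_Ici hL p₀
    refine ⟨f, hf0, fun t ht ↦ ?_⟩
    rw [← hw' _ (lorenzEnergy_le_of_solution hσ hβ hB hw' (hf0 ▸ hB₀.le) hf ht)]
    exact hf t ht
  · exact fun f hf0 hf ↦ ⟨√B + (σ + ρ), by positivity, fun t ht ↦
      norm_le_of_lorenzEnergy_le hσ hρ
        (lorenzEnergy_le_of_solution hσ hβ hB (fun _ _ ↦ rfl) (hf0 ▸ hB₀.le) hf ht)⟩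
end

section
/- There exist parameters (β, σ, ρ) in the domain A (β > 0, σ > 0, ρ > 1, ρ > (σ+1)²/(4σ)) for which the Lorenz equations admit heteroclinic connections from the origin to each wing center: there exist solutions f⁺, f⁻ : ℝ → ℝ³ of the Lorenz equations such that f±(t) → (0,0,0) as t → −∞ and f±(t) → p± as t → +∞. -/
/-- Convolution with the kernel `exp (-K τ)`, `τ ≥ 0`: the bounded solution of `w' = h - K w`. -/
noncomputable def expConv (K : ℝ) (h : ℝ → ℝ) (s : ℝ) : ℝ :=
  Real.exp (-(K * s)) * ∫ r in Set.Iic s, Real.exp (K * r) * h r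

section ExpConv

open MeasureTheory Set Filter Topology

variable {K : ℝ} {h g : ℝ → ℝ}

lemma integrableOn_exp_mul_bounded (hK : 0 < K) (hc : Continuous h) {M : ℝ}
    (hM : ∀ r, |h r| ≤ M) (s : ℝ) :
    IntegrableOn (fun r => Real.exp (K * r) * h r) (Iic s) :=
  (integrableOn_exp_mul_Iic hK s).mul_bdd hc.aestronglyMeasurable
    (Eventually.of_forall fun r => by simpa using hM r)

lemma hasDerivAt_expConv (hK : 0 < K) (hc : Continuous h) {M : ℝ}
    (hM : ∀ r, |h r| ≤ M) (s : ℝ) :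
    HasDerivAt (expConv K h) (h s - K * expConv K h s) s := by
  have hint := integrableOn_exp_mul_bounded hK hc hM
  have hcont : Continuous fun r => Real.exp (K * r) * h r := by fun_prop
  have hI : HasDerivAt (fun u => ∫ r in Iic u, Real.exp (K * r) * h r)
      (Real.exp (K * s) * h s) s := by
    have h1 : (fun u => ∫ r in Iic u, Real.exp (K * r) * h r) =
        fun u => (∫ r in Iic (0 : ℝ), Real.exp (K * r) * h r) +
          ∫ r in (0 : ℝ)..u, Real.exp (K * r) * h r := by
      funext u
      rw [← intervalIntegral.integral_Iic_sub_Iic (hint 0) (hint u)]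
      ring
    rw [h1]
    exact (intervalIntegral.integral_hasDerivAt_right (hcont.intervalIntegrable _ _)
      (hcont.stronglyMeasurableAtFilter _ _) hcont.continuousAt).const_add _
  have hE : HasDerivAt (fun u : ℝ => Real.exp (-(K * u))) (Real.exp (-(K * s)) * -(K * 1)) s :=
    (((hasDerivAt_id s).const_mul K).neg).exp
  refine (hE.mul hI).congr_deriv ?_
  have he : Real.exp (-(K * s)) * Real.exp (K * s) = 1 := by
    rw [← Real.exp_add]; simp
  unfold expConv
  linear_combination (h s) * he

lemma expConv_const (hK : 0 < K) (c s : ℝ) : expConv K (fun _ => c) s = c / K := by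
  have he : Real.exp (-(K * s)) * Real.exp (K * s) = 1 := by
    rw [← Real.exp_add]; simp
  unfold expConv
  rw [integral_mul_const, integral_exp_mul_Iic hK]
  linear_combination (c / K) * he

lemma expConv_mono (hK : 0 < K) (hc : Continuous h) (gc : Continuous g) {M N : ℝ}
    (hM : ∀ r, |h r| ≤ M) (gN : ∀ r, |g r| ≤ N) (hg : ∀ r, h r ≤ g r) (s : ℝ) :
    expConv K h s ≤ expConv K g s := by
  refine mul_le_mul_of_nonneg_left ?_ (Real.exp_pos _).le
  exact integral_mono (integrableOn_exp_mul_bounded hK hc hM s)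
    (integrableOn_exp_mul_bounded hK gc gN s)
    fun r => mul_le_mul_of_nonneg_left (hg r) (Real.exp_pos _).le

lemma expConv_add_const (hK : 0 < K) (hc : Continuous h) {M : ℝ}
    (hM : ∀ r, |h r| ≤ M) (c s : ℝ) :
    expConv K (fun r => h r + c) s = expConv K h s + c / K := by
  rw [← expConv_const hK c s]
  unfold expConv
  rw [← mul_add, ← integral_add (integrableOn_exp_mul_bounded hK hc hM s)
    (integrableOn_exp_mul_bounded hK continuous_const (fun _ => le_rfl) s)]
  simp only [mul_add]

/-- A nonautonomous scalar equation `w' = H s w - K w` with `H` bounded and `L`-Lipschitz in `w`,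
`L < K`, has a bounded solution on the whole line. -/
lemma exists_entire_solution {H : ℝ → ℝ → ℝ} (hH : Continuous fun p : ℝ × ℝ => H p.1 p.2)
    {L A B : ℝ} (hK : 0 < K) (hLK : L < K)
    (hL : ∀ s u v, |H s u - H s v| ≤ L * |u - v|)
    (hA : ∀ s u, A ≤ H s u) (hB : ∀ s u, H s u ≤ B) :
    ∃ w : ℝ → ℝ, (∀ s, HasDerivAt w (H s (w s) - K * w s) s) ∧
      ∀ s, A / K ≤ w s ∧ w s ≤ B / K := by
  have hL0 : 0 ≤ L := by
    have := (abs_nonneg _).trans (hL 0 1 0)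
    simpa using this
  have hbd : ∀ s u, |H s u| ≤ max |A| |B| := fun s u => abs_le_max_abs_abs (hA s u) (hB s u)
  have hcomp : ∀ u : BoundedContinuousFunction ℝ ℝ, Continuous fun r => H r (u r) := fun u =>
    hH.comp (continuous_id.prodMk u.continuous)
  have hder := fun (u : BoundedContinuousFunction ℝ ℝ) =>
    hasDerivAt_expConv hK (hcomp u) (fun r => hbd r (u r))
  have hlow : ∀ (u : BoundedContinuousFunction ℝ ℝ) s,
      A / K ≤ expConv K (fun r => H r (u r)) s := fun u s => by
    rw [← expConv_const hK A s]
    exact expConv_mono hK continuous_const (hcomp u) (fun _ => le_rfl) (fun r => hbd r (u r))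
      (fun r => hA r (u r)) s
  have hupp : ∀ (u : BoundedContinuousFunction ℝ ℝ) s,
      expConv K (fun r => H r (u r)) s ≤ B / K := fun u s => by
    rw [← expConv_const hK B s]
    exact expConv_mono hK (hcomp u) continuous_const (fun r => hbd r (u r)) (fun _ => le_rfl)
      (fun r => hB r (u r)) s
  let Φ : BoundedContinuousFunction ℝ ℝ → BoundedContinuousFunction ℝ ℝ := fun u =>
    BoundedContinuousFunction.ofNormedAddCommGroup (expConv K fun r => H r (u r))
      (continuous_iff_continuousAt.2 fun s => (hder u s).continuousAt)
      (max |A / K| |B / K|) (fun s => abs_le_max_abs_abs (hlow u s) (hupp u s))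
  have hone : ∀ u v : BoundedContinuousFunction ℝ ℝ, ∀ s,
      expConv K (fun r => H r (u r)) s ≤ expConv K (fun r => H r (v r)) s + L * dist u v / K := by
    intro u v s
    rw [← expConv_add_const hK (hcomp v) (fun r => hbd r (v r))]
    refine expConv_mono hK (hcomp u) ((hcomp v).add continuous_const) (fun r => hbd r (u r))
      (N := max |A| |B| + |L * dist u v|) (fun r => ?_) (fun r => ?_) s
    · exact (abs_add_le _ _).trans (add_le_add (hbd r (v r)) le_rfl)
    · change H r (u r) ≤ H r (v r) + L * dist u v
      have h1 := (abs_le.1 (hL r (u r) (v r))).2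
      have h2 : L * |u r - v r| ≤ L * dist u v :=
        mul_le_mul_of_nonneg_left (by
          simpa [Real.dist_eq] using BoundedContinuousFunction.dist_coe_le_dist (f := u) (g := v) r)
          hL0
      linarith
  have hcontr : ContractingWith (L / K).toNNReal Φ := by
    refine ⟨Real.toNNReal_lt_one.2 ((div_lt_one hK).2 hLK),
      LipschitzWith.of_dist_le_mul fun u v => ?_⟩
    rw [Real.coe_toNNReal _ (by positivity)]
    refine (BoundedContinuousFunction.dist_le (by positivity)).2 fun s => ?_
    have h1 := hone u v s
    have h2 := hone v u s
    rw [dist_comm v u] at h2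
    have h3 : L * dist u v / K = L / K * dist u v := by ring
    rw [Real.dist_eq, abs_le]
    change _ ≤ expConv K (fun r => H r (u r)) s - expConv K (fun r => H r (v r)) s ∧
      expConv K (fun r => H r (u r)) s - expConv K (fun r => H r (v r)) s ≤ _
    constructor <;> linarith
  obtain ⟨w, hw⟩ : ∃ w, Φ w = w := ⟨_, hcontr.fixedPoint_isFixedPt⟩
  have hw' : (w : ℝ → ℝ) = expConv K fun r => H r (w r) := (congrArg DFunLike.coe hw).symm
  refine ⟨w, fun s => ?_, fun s => ?_⟩
  · have := hder w s
    rwa [← hw'] at this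
  · have := And.intro (hlow w s) (hupp w s)
    rwa [← hw'] at this

end ExpConv

section TimeChange

open MeasureTheory Set Filter Topology

/-- The autonomous equation `s' = 1 / w s` with `w ≥ c > 0` has a solution on the whole line that
sweeps out the whole line. -/
lemma exists_time_change {w : ℝ → ℝ} (hw : Continuous w) {c : ℝ} (hc : 0 < c)
    (hcw : ∀ s, c ≤ w s) :
    ∃ θ : ℝ → ℝ, (∀ t, HasDerivAt θ (w (θ t))⁻¹ t) ∧ Tendsto θ atBot atBot ∧
      Tendsto θ atTop atTop := by
  set τ : ℝ → ℝ := fun s => ∫ r in (0 : ℝ)..s, w r with hτ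
  have hder : ∀ s, HasDerivAt τ (w s) s := fun s =>
    intervalIntegral.integral_hasDerivAt_right (hw.intervalIntegrable _ _)
      (hw.stronglyMeasurableAtFilter _ _) hw.continuousAt
  have hτc : Continuous τ := continuous_iff_continuousAt.2 fun s => (hder s).continuousAt
  have hmono : StrictMono τ := strictMono_of_deriv_pos fun s => by
    rw [(hder s).deriv]; exact hc.trans_le (hcw s)
  have hsub : Monotone fun s => τ s - c * s := by
    have hd : ∀ s, HasDerivAt (fun s => τ s - c * s) (w s - c * 1) s := fun s =>
      (hder s).sub ((hasDerivAt_id s).const_mul c)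
    refine monotone_of_deriv_nonneg (fun s => (hd s).differentiableAt) fun s => ?_
    rw [(hd s).deriv]
    linarith [hcw s]
  have hτ0 : τ 0 = 0 := by simp [hτ]
  have htop : Tendsto τ atTop atTop := by
    refine tendsto_atTop_mono' _ ?_ (tendsto_id.const_mul_atTop hc)
    filter_upwards [eventually_ge_atTop 0] with s hs
    have := hsub hs
    simp only [hτ0] at this
    simp only [id]
    linarith
  have hbot : Tendsto τ atBot atBot := by
    refine tendsto_atBot_mono' _ ?_ (tendsto_id.const_mul_atBot hc)
    filter_upwards [eventually_le_atBot 0] with s hs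
    have := hsub hs
    simp only [hτ0] at this
    simp only [id]
    linarith
  let e : ℝ ≃o ℝ := hmono.orderIsoOfSurjective τ (hτc.surjective htop hbot)
  have he : ∀ t, τ (e.symm t) = t := fun t => e.apply_symm_apply t
  refine ⟨e.symm, fun t => ?_, e.symm.tendsto_atBot, e.symm.tendsto_atTop⟩
  exact HasDerivAt.of_local_left_inverse e.symm.continuous.continuousAt (hder _)
    (hc.trans_le (hcw _)).ne' (Eventually.of_forall he)

end TimeChange

/-- The solution `(1 + exp (-s/4)) ^ (-1/2) / 2` of `X' = X / 8 - X ^ 3 / 2`. -/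
noncomputable def bernoulliWave (s : ℝ) : ℝ := (2 * √(1 + Real.exp (-(s / 4))))⁻¹

section BernoulliWave

open Filter Topology

lemma hasDerivAt_bernoulliWave (s : ℝ) :
    HasDerivAt bernoulliWave (bernoulliWave s / 8 - bernoulliWave s ^ 3 / 2) s := by
  have hp : 0 < 1 + Real.exp (-(s / 4)) := by positivity
  have h1 : HasDerivAt (fun u : ℝ => 1 + Real.exp (-(u / 4)))
      (Real.exp (-(s / 4)) * -(1 / 4)) s :=
    ((((hasDerivAt_id s).div_const 4).neg).exp).const_add 1
  have h2 := ((h1.sqrt hp.ne').const_mul 2).inv (by positivity)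
  refine h2.congr_deriv ?_
  have hr : √(1 + Real.exp (-(s / 4))) ^ 2 = 1 + Real.exp (-(s / 4)) := Real.sq_sqrt hp.le
  have hr0 : 0 < √(1 + Real.exp (-(s / 4))) := Real.sqrt_pos.2 hp
  have he : Real.exp (-(s / 4)) = √(1 + Real.exp (-(s / 4))) ^ 2 - 1 := by linarith
  unfold bernoulliWave
  generalize √(1 + Real.exp (-(s / 4))) = r at *
  rw [he]
  field_simp
  ring

lemma bernoulliWave_pos (s : ℝ) : 0 < bernoulliWave s := by
  unfold bernoulliWave; positivity

lemma bernoulliWave_le (s : ℝ) : bernoulliWave s ≤ 1 / 2 := by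
  unfold bernoulliWave
  rw [one_div]
  refine inv_anti₀ two_pos ?_
  have : 1 ≤ √(1 + Real.exp (-(s / 4))) := Real.one_le_sqrt.2 (by linarith [Real.exp_pos (-(s / 4))])
  linarith

lemma tendsto_bernoulliWave_atBot : Tendsto bernoulliWave atBot (𝓝 0) := by
  have h1 : Tendsto (fun s : ℝ => -(s / 4)) atBot atTop :=
    tendsto_neg_atBot_atTop.comp (tendsto_id.atBot_div_const (by norm_num))
  exact tendsto_inv_atTop_zero.comp ((Real.tendsto_sqrt_atTop.comp
    (tendsto_atTop_add_const_left _ 1 (Real.tendsto_exp_atTop.comp h1))).const_mul_atTop two_pos)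

lemma tendsto_bernoulliWave_atTop : Tendsto bernoulliWave atTop (𝓝 (1 / 2)) := by
  have h1 : Tendsto (fun s : ℝ => -(s / 4)) atTop atBot :=
    tendsto_neg_atTop_atBot.comp (tendsto_id.atTop_div_const (by norm_num))
  have h2 : Tendsto (fun s : ℝ => (2 * √(1 + Real.exp (-(s / 4))))⁻¹) atTop
      (𝓝 (2 * √(1 + 0))⁻¹) :=
    ((((Real.tendsto_exp_atBot.comp h1).const_add 1).sqrt).const_mul 2).inv₀ (by simp)
  rw [add_zero, Real.sqrt_one, mul_one, ← one_div] at h2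
  exact h2

end BernoulliWave

/-- The slope equation `w' = w (F' (X s) + 2 w - w ^ 2)` along `bernoulliWave`, where
`F x = x / 8 - x ^ 3 / 2`, has a solution on the whole line with values in `[3/2, 5/2]`. -/
lemma exists_slope : ∃ w : ℝ → ℝ,
    (∀ s, HasDerivAt w
      (w s * (1 / 8 - 3 / 2 * bernoulliWave s ^ 2 + 2 * w s - w s ^ 2)) s) ∧
    ∀ s, 3 / 2 ≤ w s ∧ w s ≤ 5 / 2 := by
  have hX : Continuous bernoulliWave :=
    continuous_iff_continuousAt.2 fun s => (hasDerivAt_bernoulliWave s).continuousAt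
  set d : ℝ → ℝ := fun s => 1 / 8 - 3 / 2 * bernoulliWave s ^ 2 with hd
  have hdc : Continuous d := by fun_prop
  have hd1 : ∀ s, d s ≤ 1 / 8 := fun s => by
    simp only [hd]; nlinarith [sq_nonneg (bernoulliWave s)]
  have hd2 : ∀ s, -(1 / 4) ≤ d s := fun s => by
    simp only [hd]; nlinarith [bernoulliWave_pos s, bernoulliWave_le s]
  set k : ℝ → ℝ := fun u => max (3 / 2) (min (5 / 2) u) with hk
  have hkc : Continuous k := by fun_prop
  have hk1 : ∀ u, 3 / 2 ≤ k u := fun u => le_max_left _ _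
  have hk2 : ∀ u, k u ≤ 5 / 2 := fun u => max_le (by norm_num) (min_le_left _ _)
  have hkL : ∀ u v, |k u - k v| ≤ |u - v| := fun u v =>
    (abs_max_sub_max_le_max _ _ _ _).trans (by
      simpa using abs_min_sub_min_le_max (5 / 2 : ℝ) u (5 / 2) v)
  have hkid : ∀ u, 3 / 2 ≤ u → u ≤ 5 / 2 → k u = u := fun u h1 h2 => by
    simp [hk, h1, h2]
  obtain ⟨w, hw, hb⟩ := exists_entire_solution
    (H := fun s u => 10 * k u + k u * (d s + 2 * k u - k u ^ 2)) (K := 10) (L := 19 / 2)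
    (A := 15) (B := 25) (by fun_prop) (by norm_num) (by norm_num)
    (fun s u v => by
      have h1 := hk1 u; have h2 := hk2 u; have h3 := hk1 v; have h4 := hk2 v
      have h5 := hd1 s; have h6 := hd2 s
      have e : 10 * k u + k u * (d s + 2 * k u - k u ^ 2) -
          (10 * k v + k v * (d s + 2 * k v - k v ^ 2)) =
          (10 + d s + 2 * (k u + k v) - (k u ^ 2 + k u * k v + k v ^ 2)) * (k u - k v) := by ring
      rw [e, abs_mul]
      refine mul_le_mul (abs_le.2 ⟨?_, ?_⟩) (hkL u v) (abs_nonneg _) (by norm_num)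
      · nlinarith
      · nlinarith)
    (fun s u => by
      have h1 := hk1 u; have h2 := hk2 u
      have h5 := hd1 s; have h6 := hd2 s
      have := mul_nonneg (sub_nonneg.2 h1) (sub_nonneg.2 h2)
      nlinarith)
    (fun s u => by
      have h1 := hk1 u; have h2 := hk2 u
      have h5 := hd1 s; have h6 := hd2 s
      have := mul_nonneg (sub_nonneg.2 h1) (sub_nonneg.2 h2)
      nlinarith)
  have hb' : ∀ s, 3 / 2 ≤ w s ∧ w s ≤ 5 / 2 := fun s => by
    have := hb s; constructor <;> linarith [this.1, this.2]
  refine ⟨w, fun s => ?_, hb'⟩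
  have := hw s
  rw [hkid _ (hb' s).1 (hb' s).2] at this
  convert this using 1
  ring

/-- The damped Duffing equation `x'' + 2 x' = x / 8 - x ^ 3 / 2` has a solution running from the
saddle `0` to the sink `1 / 2`. -/
lemma exists_duffing_connection : ∃ x v : ℝ → ℝ,
    (∀ t, HasDerivAt x (v t) t) ∧
    (∀ t, HasDerivAt v (x t / 8 - x t ^ 3 / 2 - 2 * v t) t) ∧
    Filter.Tendsto x Filter.atBot (nhds 0) ∧ Filter.Tendsto v Filter.atBot (nhds 0) ∧
    Filter.Tendsto x Filter.atTop (nhds (1 / 2)) ∧ Filter.Tendsto v Filter.atTop (nhds 0) := by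
  obtain ⟨w, hw, hb⟩ := exists_slope
  have hw0 : ∀ s, w s ≠ 0 := fun s => ((by norm_num : (0 : ℝ) < 3 / 2).trans_le (hb s).1).ne'
  obtain ⟨θ, hθ, hbot, htop⟩ := exists_time_change
    (continuous_iff_continuousAt.2 fun s => (hw s).continuousAt)
    (by norm_num : (0 : ℝ) < 3 / 2) (fun s => (hb s).1)
  have hF : ∀ {l : Filter ℝ} {a : ℝ}, a / 8 - a ^ 3 / 2 = 0 →
      Filter.Tendsto bernoulliWave l (nhds a) →
      Filter.Tendsto (fun s => (bernoulliWave s / 8 - bernoulliWave s ^ 3 / 2) * (w s)⁻¹) l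
        (nhds 0) := fun {l a} ha hX => by
    refine Filter.Tendsto.zero_mul_isBoundedUnder_le ?_ ?_
    · rw [← ha]
      exact (hX.div_const 8).sub ((hX.pow 3).div_const 2)
    · refine Filter.isBoundedUnder_of ⟨1, fun s => ?_⟩
      have h1 := (hb s).1
      simp only [Function.comp, norm_inv, Real.norm_eq_abs]
      exact inv_le_one_of_one_le₀ (le_trans (by linarith) (le_abs_self _))
  refine ⟨fun t => bernoulliWave (θ t),
    fun t => (bernoulliWave (θ t) / 8 - bernoulliWave (θ t) ^ 3 / 2) * (w (θ t))⁻¹,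
    fun t => (hasDerivAt_bernoulliWave (θ t)).comp t (hθ t), fun t => ?_,
    tendsto_bernoulliWave_atBot.comp hbot, (hF (by norm_num) tendsto_bernoulliWave_atBot).comp hbot,
    tendsto_bernoulliWave_atTop.comp htop, (hF (by norm_num) tendsto_bernoulliWave_atTop).comp htop⟩
  have hX := hasDerivAt_bernoulliWave (θ t)
  have h1 := (((hX.div_const 8).sub ((hX.pow 3).div_const 2)).mul ((hw (θ t)).inv (hw0 _))).comp t
    (hθ t)
  refine h1.congr_deriv ?_
  have := hw0 (θ t)
  simp only [Pi.sub_apply, Pi.pow_apply, Pi.inv_apply]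
  field_simp
  ring

/-- There is a parameter value `(β, σ, ρ)` in the domain `A` (a "T-point") at
which the Lorenz equations admit heteroclinic connections from the origin to each
of the two wing centers `p± = (±√(β(ρ−1)), ±√(β(ρ−1)), ρ−1)`. -/
theorem exists_Tpoint_heteroclinic_connections :
    ∃ β σ ρ : ℝ,
      0 < β ∧ 0 < σ ∧ 1 < ρ ∧ (σ + 1) ^ 2 / (4 * σ) < ρ ∧
      ∃ fp fm : ℝ → Fin 3 → ℝ,
        (∀ t : ℝ, HasDerivAt fp (lorenz σ ρ β (fp t)) t) ∧
        Filter.Tendsto fp Filter.atBot (nhds ![0, 0, 0]) ∧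
        Filter.Tendsto fp Filter.atTop
          (nhds ![Real.sqrt (β * (ρ - 1)), Real.sqrt (β * (ρ - 1)), ρ - 1]) ∧
        (∀ t : ℝ, HasDerivAt fm (lorenz σ ρ β (fm t)) t) ∧
        Filter.Tendsto fm Filter.atBot (nhds ![0, 0, 0]) ∧
        Filter.Tendsto fm Filter.atTop
          (nhds ![-Real.sqrt (β * (ρ - 1)), -Real.sqrt (β * (ρ - 1)), ρ - 1]) := by
  obtain ⟨x, v, hx, hv, hxb, hvb, hxt, hvt⟩ := exists_duffing_connection
  have hs : Real.sqrt (2 * (9 / 8 - 1)) = 1 / 2 := by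
    rw [show (2 * (9 / 8 - 1) : ℝ) = (1 / 2) ^ 2 by norm_num]
    exact Real.sqrt_sq (by norm_num)
  -- On the invariant surface `x ^ 2 = 2 z` the flow reduces to the Duffing equation.
  have key : ∀ ε : ℝ, ε ^ 2 = 1 → ∃ f : ℝ → Fin 3 → ℝ,
      (∀ t : ℝ, HasDerivAt f (lorenz 1 (9 / 8) 2 (f t)) t) ∧
      Filter.Tendsto f Filter.atBot (nhds ![0, 0, 0]) ∧
      Filter.Tendsto f Filter.atTop (nhds ![ε * (1 / 2), ε * (1 / 2), 9 / 8 - 1]) := by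
    intro ε hε
    refine ⟨fun t => ![ε * x t, ε * (x t + v t), x t ^ 2 / 2], fun t => ?_, ?_, ?_⟩
    · rw [hasDerivAt_pi]
      intro i
      fin_cases i
      · refine ((hx t).const_mul ε).congr_deriv ?_
        simp [lorenz]
        ring
      · refine (((hx t).add (hv t)).const_mul ε).congr_deriv ?_
        simp [lorenz]
        ring
      · refine (((hx t).pow 2).div_const 2).congr_deriv ?_
        simp [lorenz]
        linear_combination -(x t * (x t + v t)) * hε
    · rw [tendsto_pi_nhds]
      intro i
      fin_cases i
      · simpa using hxb.const_mul ε
      · simpa using (hxb.add hvb).const_mul ε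
      · simpa using (hxb.pow 2).div_const 2
    · rw [tendsto_pi_nhds]
      intro i
      fin_cases i
      · simpa using hxt.const_mul ε
      · simpa using (hxt.add hvt).const_mul ε
      · have := (hxt.pow 2).div_const 2
        norm_num at this ⊢
        exact this
  obtain ⟨fp, hp1, hp2, hp3⟩ := key 1 (by norm_num)
  obtain ⟨fm, hm1, hm2, hm3⟩ := key (-1) (by norm_num)
  refine ⟨2, 1, 9 / 8, by norm_num, by norm_num, by norm_num, by norm_num, fp, fm, hp1, hp2, ?_,
    hm1, hm2, ?_⟩
  · rw [hs]
    simpa only [one_mul] using hp3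
  · rw [hs]
    simpa only [neg_mul, one_mul] using hm3
end

section
/- Let σ, β > 0, ρ > 1, x₀ = √(β(ρ−1)), and let J = [[−σ, σ, 0], [1, −1, −x₀], [x₀, x₀, −β]] be the Jacobian of the Lorenz vector field at the wing center p⁺. Then: (i) every real eigenvector v = (v₁, v₂, v₃) of J has v₁ ≠ 0; and (ii) if v is a real eigenvector for a real eigenvalue λ < 0 with v₁ > 0, then v₂ < v₁ (so v points into the quadrant {(x,y,z) : x ≥ x₀, y ≤ x}). -/
/-- For the Jacobian `J = [[−σ, σ, 0], [1, −1, −x₀], [x₀, x₀, −β]]` of the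
Lorenz vector field at the wing center `p⁺` (`x₀ = √(β(ρ−1))`):
(i) every real eigenvector `v` of `J` has first coordinate `v₁ ≠ 0`; and
(ii) any real eigenvector for a negative real eigenvalue normalized so that
`v₁ > 0` satisfies `v₂ < v₁`, hence points into the quadrant
`{x ≥ x₀, y ≤ x}`. -/
theorem wing_center_eigenvector_direction (σ ρ β : ℝ) (hσ : 0 < σ) (hβ : 0 < β)
    (hρ : 1 < ρ) :
    let x₀ : ℝ := Real.sqrt (β * (ρ - 1))
    let J : Matrix (Fin 3) (Fin 3) ℝ := !![-σ, σ, 0; 1, -1, -x₀; x₀, x₀, -β]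
    (∀ (lam : ℝ) (v : Fin 3 → ℝ), v ≠ 0 → J.mulVec v = lam • v → v 0 ≠ 0) ∧
    (∀ (lam : ℝ) (v : Fin 3 → ℝ), lam < 0 → v ≠ 0 → J.mulVec v = lam • v →
      0 < v 0 → v 1 < v 0) := by
  intro x₀ J
  have hx₀ : 0 < x₀ := Real.sqrt_pos.mpr (mul_pos hβ (sub_pos.mpr hρ))
  have first_row (lam : ℝ) (v : Fin 3 → ℝ) (h : J.mulVec v = lam • v) :
      σ * (v 1 - v 0) = lam * v 0 := by
    have h₀ := congrFun h 0
    simp [J, Matrix.mulVec, dotProduct, Fin.sum_univ_three] at h₀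
    linarith
  have second_row (lam : ℝ) (v : Fin 3 → ℝ) (h : J.mulVec v = lam • v) :
      v 0 - v 1 - x₀ * v 2 = lam * v 1 := by
    have h₁ := congrFun h 1
    simp [J, Matrix.mulVec, dotProduct, Fin.sum_univ_three] at h₁
    linarith
  refine ⟨fun lam v hv h h0 => hv ?_, fun lam v hlam _ h hpos => ?_⟩
  · have h1 : v 1 = 0 := by simpa [h0, hσ.ne'] using first_row lam v h
    have h2 : v 2 = 0 := by simpa [h0, h1, hx₀.ne'] using second_row lam v h
    ext i
    fin_cases i <;> simp [h0, h1, h2]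
  · have hneg : σ * (v 1 - v 0) < 0 :=
      first_row lam v h ▸ mul_neg_of_neg_of_pos hlam hpos
    exact sub_neg.mp (neg_of_mul_neg_right hneg hσ.le)
end
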